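/- arXiv:2308.04293 — 2 statements merged into one kernel-verified Lean document; each statement's English description precedes it below -/
import Mathlib

section
/- Let T be the Bolyai–Rényi map and μ a T-invariant Borel probability measure on [0,1) absolutely continuous with respect to Lebesgue measure. Let ε > 0 and α, β > 0, and suppose there exist continuous functions g, f : [0,1] → ℝ, positive everywhere on [0,1], such that (L_ε g)(x) ≤ e^{−α} g(x) for all x ∈ [0,1] and (L_{−ε} f)(x) ≤ e^{β} f(x) for all x ∈ [0,1]. Then α/ε ≤ ∫ log(2x+2) dμ(x) ≤ β/ε; that is, the metric entropy h(μ) lies between α/ε and β/ε. -/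
open MeasureTheory Real Filter

/-- The Bolyai–Rényi map. -/
noncomputable def T (x : ℝ) : ℝ :=
  if x < Real.sqrt 2 - 1 then x ^ 2 + 2 * x
  else if x < Real.sqrt 3 - 1 then x ^ 2 + 2 * x - 1
  else x ^ 2 + 2 * x - 2

/-- The transfer operator of the Bolyai–Rényi map at parameter `t`. -/
noncomputable def Lt (t : ℝ) (f : ℝ → ℝ) : ℝ → ℝ := fun x =>
  ∑ i ∈ Finset.Icc (1 : ℕ) 3,
    (2 * Real.sqrt ((i : ℝ) + x)) ^ (-(1 + t)) * f (Real.sqrt ((i : ℝ) + x) - 1)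

lemma measurable_T : Measurable T := by
  unfold T
  refine Measurable.ite measurableSet_Iio (by fun_prop) (Measurable.ite measurableSet_Iio (by fun_prop) (by fun_prop))

lemma T_mem {x : ℝ} (hx : x ∈ Set.Ico (0:ℝ) 1) : T x ∈ Set.Ico (0:ℝ) 1 := by
  obtain ⟨h0, h1⟩ := hx
  have h2 := Real.sq_sqrt (show (0:ℝ) ≤ 2 by norm_num)
  have h3 := Real.sq_sqrt (show (0:ℝ) ≤ 3 by norm_num)
  have p2 := Real.sqrt_nonneg 2
  have p3 := Real.sqrt_nonneg 3
  unfold T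
  split_ifs with ha hb
  · constructor <;> nlinarith
  · push Not at ha
    constructor <;> nlinarith
  · push Not at ha hb
    constructor <;> nlinarith

/-- One branch of the change of variables. -/
lemma branch (c a b : ℝ) (ha : 0 ≤ a) (hab : a ≤ b) (hca : a ^ 2 + 2 * a + 1 = c)
    (hcb : b ^ 2 + 2 * b = c) (s γ : ℝ) (g : ℝ → ℝ) (H : ℝ → ENNReal)
    (hT : ∀ x ∈ Set.Ico a b, T x = x ^ 2 + 2 * x + 1 - c) :
    ∫⁻ x in Set.Ico a b, H (T x) * ENNReal.ofReal (Real.exp (-s * Real.log (2 * x + 2) - γ) * g x)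
      = ∫⁻ y in Set.Ico (0:ℝ) 1, H y * ENNReal.ofReal (Real.exp (-γ) *
          ((2 * Real.sqrt (c + y)) ^ (-(1 + s)) * g (Real.sqrt (c + y) - 1))) := by
  have himg : (fun x : ℝ => x ^ 2 + 2 * x + 1 - c) '' Set.Ico a b = Set.Ico 0 1 := by
    ext y
    simp only [Set.mem_image, Set.mem_Ico]
    constructor
    · rintro ⟨x, ⟨h1, h2⟩, rfl⟩
      constructor <;> nlinarith
    · rintro ⟨h1, h2⟩
      have hc : 0 ≤ c + y := by nlinarith
      have hs := Real.sq_sqrt hc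
      have hn := Real.sqrt_nonneg (c + y)
      refine ⟨Real.sqrt (c + y) - 1, ⟨?_, ?_⟩, ?_⟩
      · have : a + 1 ≤ Real.sqrt (c + y) := Real.le_sqrt_of_sq_le (by nlinarith)
        linarith
      · have : Real.sqrt (c + y) < b + 1 := by
          rw [Real.sqrt_lt' (by linarith)]; nlinarith
        linarith
      · nlinarith
  have hinj : Set.InjOn (fun x : ℝ => x ^ 2 + 2 * x + 1 - c) (Set.Ico a b) := by
    intro x hx y hy h
    have h' : (x - y) * (x + y + 2) = 0 := by
      have h2 : x ^ 2 + 2 * x + 1 - c = y ^ 2 + 2 * y + 1 - c := h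
      linarith
    rcases mul_eq_zero.1 h' with h | h
    · linarith
    · have := hx.1; have := hy.1; linarith
  have key := lintegral_image_eq_lintegral_abs_deriv_mul (measurableSet_Ico (a := a) (b := b))
    (f' := fun x => 2 * x + 2)
    (fun x _ => by
      have : HasDerivAt (fun x : ℝ => x ^ 2 + 2 * x + 1 - c) (2 * x + 2) x := by
        have h : HasDerivAt (fun x : ℝ => x ^ 2 + 2 * x + 1 - c) (((2 : ℕ) : ℝ) * x ^ (2 - 1) + 2 * 1) x :=
          (((hasDerivAt_pow 2 x).add ((hasDerivAt_id' x).const_mul 2)).add_const 1).sub_const c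
        have e : ((2 : ℕ) : ℝ) * x ^ (2 - 1) + 2 * 1 = 2 * x + 2 := by norm_num
        rwa [e] at h
      exact this.hasDerivWithinAt) hinj
    (fun y => H y * ENNReal.ofReal (Real.exp (-γ) *
          ((2 * Real.sqrt (c + y)) ^ (-(1 + s)) * g (Real.sqrt (c + y) - 1))))
  rw [himg] at key
  rw [key]
  refine setLIntegral_congr_fun measurableSet_Ico fun x hx => ?_
  have hx0 : 0 ≤ x := ha.trans hx.1
  have hp : 0 < 2 * x + 2 := by linarith
  have e1 : Real.sqrt (c + (x ^ 2 + 2 * x + 1 - c)) = x + 1 := by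
    rw [show c + (x ^ 2 + 2 * x + 1 - c) = (x + 1) ^ 2 by ring]
    exact Real.sqrt_sq (by linarith)
  simp only [hT x hx, e1]
  rw [mul_left_comm, ← ENNReal.ofReal_mul (abs_nonneg _), abs_of_pos hp]
  congr 2
  rw [show 2 * (x + 1) = 2 * x + 2 by ring, show x + 1 - 1 = x by ring,
    Real.rpow_def_of_pos hp]
  have : (2 * x + 2) = Real.exp (Real.log (2 * x + 2)) := (Real.exp_log hp).symm
  nth_rw 2 [this]
  rw [← mul_assoc, ← mul_assoc, ← Real.exp_add, ← Real.exp_add]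
  congr 2
  ring

lemma transfer (s γ : ℝ) (g : ℝ → ℝ) (hg : Continuous g) (hpos : ∀ x, 0 < g x)
    (hb : ∀ x ∈ Set.Icc (0:ℝ) 1, Lt s g x ≤ Real.exp γ * g x)
    (H : ℝ → ENNReal) (hH : Measurable H) :
    ∫⁻ x in Set.Ico (0:ℝ) 1,
        H (T x) * ENNReal.ofReal (Real.exp (-s * Real.log (2 * x + 2) - γ) * g x)
      ≤ ∫⁻ y in Set.Ico (0:ℝ) 1, H y * ENNReal.ofReal (g y) := by
  have h2 := Real.sq_sqrt (show (0:ℝ) ≤ 2 by norm_num)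
  have h3 := Real.sq_sqrt (show (0:ℝ) ≤ 3 by norm_num)
  have p2 := Real.sqrt_nonneg 2
  have p3 := Real.sqrt_nonneg 3
  have l1 : 1 ≤ Real.sqrt 2 := by nlinarith
  have l2 : Real.sqrt 2 ≤ Real.sqrt 3 := by nlinarith
  have l3 : Real.sqrt 3 ≤ 2 := by nlinarith
  have u1 : Set.Ico (0:ℝ) 1 = (Set.Ico 0 (Real.sqrt 2 - 1) ∪ Set.Ico (Real.sqrt 2 - 1) (Real.sqrt 3 - 1))
      ∪ Set.Ico (Real.sqrt 3 - 1) 1 := by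
    rw [Set.Ico_union_Ico_eq_Ico (by linarith) (by linarith),
      Set.Ico_union_Ico_eq_Ico (by linarith) (by linarith)]
  have b1 := branch 1 0 (Real.sqrt 2 - 1) le_rfl (by linarith) (by norm_num) (by nlinarith) s γ g H
    (fun x hx => by
      have := hx.2
      simp only [T, this, if_true]; ring)
  have b2 := branch 2 (Real.sqrt 2 - 1) (Real.sqrt 3 - 1) (by linarith) (by linarith)
    (by nlinarith) (by nlinarith) s γ g H
    (fun x hx => by
      have := hx.2
      have h' : ¬ x < Real.sqrt 2 - 1 := not_lt.2 hx.1
      simp only [T, this, h', if_true, if_false]; ring)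
  have b3 := branch 3 (Real.sqrt 3 - 1) 1 (by linarith) (by linarith)
    (by nlinarith) (by norm_num) s γ g H
    (fun x hx => by
      have h'' : ¬ x < Real.sqrt 3 - 1 := not_lt.2 hx.1
      have h' : ¬ x < Real.sqrt 2 - 1 := not_lt.2 (by linarith [hx.1])
      simp only [T, h', h'', if_false]; ring)
  have hms : ∀ c : ℝ, Measurable fun y => H y * ENNReal.ofReal (Real.exp (-γ) *
          ((2 * Real.sqrt (c + y)) ^ (-(1 + s)) * g (Real.sqrt (c + y) - 1))) := by
    intro c
    have := hg.measurable
    fun_prop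
  conv_lhs => rw [u1]
  rw [lintegral_union measurableSet_Ico, lintegral_union measurableSet_Ico, b1, b2, b3,
    ← lintegral_add_left (hms 1), ← lintegral_add_right _ (hms 3)]
  · refine setLIntegral_mono' measurableSet_Ico fun y hy => ?_
    have hn : ∀ c : ℝ, 0 ≤ Real.exp (-γ) *
          ((2 * Real.sqrt (c + y)) ^ (-(1 + s)) * g (Real.sqrt (c + y) - 1)) := by
      intro c
      have := hpos (Real.sqrt (c + y) - 1)
      positivity
    rw [← mul_add, ← mul_add, ← ENNReal.ofReal_add (hn 1) (hn 2),
      ← ENNReal.ofReal_add (add_nonneg (hn 1) (hn 2)) (hn 3)]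
    gcongr
    have hb' := hb y ⟨hy.1, hy.2.le⟩
    simp only [Lt, Finset.sum_Icc_succ_top (show 1 ≤ 2 + 1 by norm_num), Finset.sum_Icc_succ_top (show 1 ≤ 1 + 1 by norm_num), Finset.Icc_self, Finset.sum_singleton] at hb'
    norm_num at hb'
    rw [← mul_add, ← mul_add]
    calc _ ≤ Real.exp (-γ) * (Real.exp γ * g y) := by
            gcongr
            norm_num
            exact hb'
      _ = g y := by rw [← mul_assoc, ← Real.exp_add]; simp
  · rw [Set.disjoint_left]; intro x hx hx'; exact absurd hx'.1 (not_le.2 hx.2)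
  · rw [Set.disjoint_left]; intro x hx hx'
    have := hx'.1
    rcases hx with hx | hx <;> linarith [hx.2]

noncomputable def phi (x : ℝ) : ℝ := Real.log (2 * x + 2)

noncomputable def Fn (s γ : ℝ) (n : ℕ) (x : ℝ) : ℝ := -s * birkhoffSum T phi n x - n * γ

lemma measurable_phi : Measurable phi := by unfold phi; fun_prop

lemma measurable_Fn (s γ : ℝ) (n : ℕ) : Measurable (Fn s γ n) := by
  have : Measurable (birkhoffSum T phi n) := by
    unfold birkhoffSum
    refine Finset.measurable_sum _ fun k _ => measurable_phi.comp (measurable_T.iterate k)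
  unfold Fn
  fun_prop

lemma exp_Fn (s γ : ℝ) (g : ℝ → ℝ) (hg : Continuous g) (hpos : ∀ x, 0 < g x)
    (hb : ∀ x ∈ Set.Icc (0:ℝ) 1, Lt s g x ≤ Real.exp γ * g x) (n : ℕ) :
    ∫⁻ x in Set.Ico (0:ℝ) 1, ENNReal.ofReal (Real.exp (Fn s γ n x)) * ENNReal.ofReal (g x)
      ≤ ∫⁻ x in Set.Ico (0:ℝ) 1, ENNReal.ofReal (g x) := by
  induction n with
  | zero => simp [Fn]
  | succ n ih =>
    refine le_trans ?_ ih
    have := measurable_Fn s γ n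
    refine le_trans (le_of_eq ?_) (transfer s γ g hg hpos hb
      (fun x => ENNReal.ofReal (Real.exp (Fn s γ n x))) (by fun_prop))
    refine lintegral_congr fun x => ?_
    rw [← ENNReal.ofReal_mul (Real.exp_nonneg _), ← ENNReal.ofReal_mul (Real.exp_nonneg _),
      ← mul_assoc, ← Real.exp_add]
    congr 3
    simp only [Fn, birkhoffSum_succ', phi]
    push_cast
    ring

lemma phi_bound {x : ℝ} (hx : x ∈ Set.Ico (0:ℝ) 1) : |phi x| ≤ Real.log 4 := by
  have h1 : 0 ≤ phi x := Real.log_nonneg (by linarith [hx.1])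
  rw [abs_of_nonneg h1]
  exact Real.log_le_log (by linarith [hx.1]) (by linarith [hx.2])

lemma iter_mem {x : ℝ} (hx : x ∈ Set.Ico (0:ℝ) 1) (k : ℕ) : T^[k] x ∈ Set.Ico (0:ℝ) 1 := by
  induction k with
  | zero => simpa using hx
  | succ k ih => rw [Function.iterate_succ_apply']; exact T_mem ih

lemma Fn_bound (s γ : ℝ) (n : ℕ) {x : ℝ} (hx : x ∈ Set.Ico (0:ℝ) 1) :
    |Fn s γ n x| ≤ n * (|s| * Real.log 4 + |γ|) := by
  have h : |birkhoffSum T phi n x| ≤ n * Real.log 4 := by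
    unfold birkhoffSum
    refine (Finset.abs_sum_le_sum_abs _ _).trans ?_
    refine (Finset.sum_le_card_nsmul _ _ (Real.log 4) fun k _ => phi_bound (iter_mem hx k)).trans ?_
    simp
  unfold Fn
  calc _ ≤ |-s * birkhoffSum T phi n x| + |n * γ| := abs_sub _ _
    _ = |s| * |birkhoffSum T phi n x| + n * |γ| := by simp [abs_mul]
    _ ≤ |s| * (n * Real.log 4) + n * |γ| := by gcongr
    _ = _ := by ring

lemma good_set (μ : Measure ℝ) [IsProbabilityMeasure μ] (hac : μ ≪ volume) (δ : ℝ) (hδ : 0 < δ) :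
    ∃ (B : Set ℝ) (M : ℕ), MeasurableSet B ∧ μ.real Bᶜ ≤ δ ∧
      ∀ F : ℝ → ENNReal, Measurable F → ∫⁻ x in B, F x ∂μ ≤ M * ∫⁻ x, F x := by
  set ρ := μ.rnDeriv volume with hρ
  have hm : Measurable ρ := Measure.measurable_rnDeriv _ _
  have hd : volume.withDensity ρ = μ := Measure.withDensity_rnDeriv_eq _ _ hac
  let A : ℕ → Set ℝ := fun M => {x | (M : ENNReal) < ρ x}
  have hA : ∀ M, MeasurableSet (A M) := fun M => measurableSet_lt measurable_const hm
  have ht : Tendsto (fun M => μ (A M)) atTop (nhds (μ (⋂ M, A M))) :=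
    tendsto_measure_iInter_atTop (fun M => (hA M).nullMeasurableSet)
      (fun i j hij x hx => by
        have hij' : (i : ENNReal) ≤ j := by exact_mod_cast hij
        exact lt_of_le_of_lt hij' hx) ⟨0, measure_ne_top _ _⟩
  have h0 : μ (⋂ M, A M) = 0 := by
    apply hac
    have := Measure.rnDeriv_lt_top μ (volume : Measure ℝ)
    refine measure_mono_null (t := {x | ¬ ρ x < ⊤}) ?_ (ae_iff.1 this)
    intro x hx hlt
    obtain ⟨n, hn⟩ := ENNReal.exists_nat_gt hlt.ne
    exact lt_asymm hn (Set.mem_iInter.1 hx n)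
  rw [h0] at ht
  obtain ⟨M, hM⟩ := (ht.eventually (gt_mem_nhds (ENNReal.ofReal_pos.2 hδ))).exists
  refine ⟨(A M)ᶜ, M, (hA M).compl, ?_, ?_⟩
  · rw [compl_compl]
    exact ENNReal.toReal_le_of_le_ofReal hδ.le hM.le
  · intro F hF
    rw [← hd, setLIntegral_withDensity_eq_setLIntegral_mul _ hm hF (hA M).compl,
      ← lintegral_const_mul _ hF]
    refine (setLIntegral_mono' (hA M).compl fun x hx => ?_).trans (setLIntegral_le_lintegral _ _)
    have : ρ x ≤ M := not_lt.1 hx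
    simp only [Pi.mul_apply]
    gcongr

lemma main_bound (μ : Measure ℝ) [IsProbabilityMeasure μ]
    (hsupp : μ (Set.Ico (0 : ℝ) 1)ᶜ = 0)
    (hinv : ∀ A : Set ℝ, MeasurableSet A → μ (T ⁻¹' A) = μ A)
    (hac : μ ≪ volume) (s γ : ℝ) (g : ℝ → ℝ) (hg : Continuous g)
    (m C : ℝ) (hm : 0 < m) (hgm : ∀ x, m ≤ g x) (hgC : ∀ x, g x ≤ C)
    (hb : ∀ x ∈ Set.Icc (0:ℝ) 1, Lt s g x ≤ Real.exp γ * g x) :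
    -s * (∫ x, phi x ∂μ) ≤ γ := by
  have hae : ∀ᵐ x ∂μ, x ∈ Set.Ico (0:ℝ) 1 := by
    rw [ae_iff]; exact hsupp
  have hTp : MeasurePreserving T μ μ :=
    ⟨measurable_T, by ext A hA; rw [Measure.map_apply measurable_T hA, hinv A hA]⟩
  have hpos : ∀ x, 0 < g x := fun x => hm.trans_le (hgm x)
  have iphi : Integrable phi μ := by
    refine Integrable.of_bound measurable_phi.aestronglyMeasurable (Real.log 4) ?_
    filter_upwards [hae] with x hx using phi_bound hx
  set K := |s| * Real.log 4 + |γ| with hK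
  have hK0 : 0 ≤ K := by have := Real.log_nonneg (show (1:ℝ) ≤ 4 by norm_num); positivity
  have iF : ∀ n, Integrable (Fn s γ n) μ := fun n => by
    refine Integrable.of_bound (measurable_Fn s γ n).aestronglyMeasurable (n * K) ?_
    filter_upwards [hae] with x hx using Fn_bound s γ n hx
  have hintF : ∀ n : ℕ, ∫ x, Fn s γ n x ∂μ = n * (-s * (∫ x, phi x ∂μ) - γ) := by
    intro n
    have ib : ∀ k, Integrable (fun x => phi (T^[k] x)) μ := fun k =>
      (hTp.iterate k).integrable_comp_of_integrable iphi
    have eb : ∀ k, ∫ x, phi (T^[k] x) ∂μ = ∫ x, phi x ∂μ := fun k => by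
      have h := hTp.iterate k
      have h' := integral_map (μ := μ) h.measurable.aemeasurable (f := phi)
        measurable_phi.aestronglyMeasurable
      rw [h.map_eq] at h'
      exact h'.symm
    unfold Fn birkhoffSum
    rw [integral_sub ((integrable_finsetSum _ fun k _ => ib k).const_mul _) (integrable_const _),
      integral_const_mul, integral_finsetSum _ fun k _ => ib k]
    simp only [eb]
    simp
    ring
  set h := ∫ x, phi x ∂μ with hh
  -- bound for each δ
  have key : ∀ δ > 0, -s * h - γ ≤ K * δ := by
    intro δ hδ
    obtain ⟨B, M, hB, hBδ, hBF⟩ := good_set μ hac δ hδ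
    have step : ∀ n : ℕ, n * (-s * h - γ) ≤ M * (C / m) + n * (K * δ) := by
      intro n
      have mF := measurable_Fn s γ n
      rw [← hintF n, ← integral_add_compl hB (iF n)]
      have iE : Integrable (fun x => Real.exp (Fn s γ n x)) μ := by
        refine Integrable.of_bound (by fun_prop) (Real.exp (n * K)) ?_
        filter_upwards [hae] with x hx
        rw [Real.norm_eq_abs, Real.abs_exp]
        exact Real.exp_le_exp.2 ((le_abs_self _).trans (Fn_bound s γ n hx))
      refine add_le_add ?_ ?_
      · calc ∫ x in B, Fn s γ n x ∂μ ≤ ∫ x in B, Real.exp (Fn s γ n x) ∂μ :=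
              integral_mono (iF n).integrableOn iE.integrableOn
                (fun x => by have := Real.add_one_le_exp (Fn s γ n x); linarith)
          _ ≤ M * (C / m) := by
              rw [integral_eq_lintegral_of_nonneg_ae
                (Filter.Eventually.of_forall fun x => Real.exp_nonneg _)
                (by fun_prop)]
              have hC : 0 ≤ C := (hpos 0).le.trans (hgC 0)
              refine ENNReal.toReal_le_of_le_ofReal (by positivity) ?_
              set I : Set ℝ := Set.Ico 0 1
              have hI : MeasurableSet I := measurableSet_Ico
              have mE : Measurable fun x => ENNReal.ofReal (Real.exp (Fn s γ n x)) := by fun_prop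
              calc ∫⁻ x in B, ENNReal.ofReal (Real.exp (Fn s γ n x)) ∂μ
                  = ∫⁻ x in B, I.indicator (fun x => ENNReal.ofReal (Real.exp (Fn s γ n x))) x ∂μ := by
                    refine lintegral_congr_ae (ae_restrict_of_ae ?_)
                    filter_upwards [hae] with x hx
                    rw [Set.indicator_of_mem hx]
                _ ≤ M * ∫⁻ x, I.indicator (fun x => ENNReal.ofReal (Real.exp (Fn s γ n x))) x :=
                    hBF _ (mE.indicator hI)
                _ = M * ∫⁻ x in I, ENNReal.ofReal (Real.exp (Fn s γ n x)) := by
                    rw [lintegral_indicator hI]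
                _ ≤ M * ∫⁻ x in I, ENNReal.ofReal (1 / m) *
                      (ENNReal.ofReal (Real.exp (Fn s γ n x)) * ENNReal.ofReal (g x)) := by
                    gcongr with x
                    rw [← ENNReal.ofReal_mul (Real.exp_nonneg _), ← ENNReal.ofReal_mul (by positivity)]
                    refine ENNReal.ofReal_le_ofReal ?_
                    rw [one_div, ← div_eq_inv_mul, le_div_iff₀ hm]
                    gcongr
                    exact hgm x
                _ = M * (ENNReal.ofReal (1 / m) * ∫⁻ x in I,
                      ENNReal.ofReal (Real.exp (Fn s γ n x)) * ENNReal.ofReal (g x)) := by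
                    rw [lintegral_const_mul']
                    exact ENNReal.ofReal_ne_top
                _ ≤ M * (ENNReal.ofReal (1 / m) * ∫⁻ x in I, ENNReal.ofReal (g x)) := by
                    have := exp_Fn s γ g hg hpos hb n
                    exact mul_le_mul_right (mul_le_mul_right this _) _
                _ ≤ M * (ENNReal.ofReal (1 / m) * ∫⁻ x in I, ENNReal.ofReal C) := by
                    gcongr with x
                    exact hgC x
                _ = ENNReal.ofReal (M * (C / m)) := by
                    rw [setLIntegral_const, Real.volume_Ico, sub_zero, ENNReal.ofReal_one, mul_one,
                      ← ENNReal.ofReal_mul (by positivity),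
                      ENNReal.ofReal_mul (p := (M : ℝ)) (by positivity),
                      ENNReal.ofReal_natCast]
                    congr 2
                    ring
      · calc ∫ x in Bᶜ, Fn s γ n x ∂μ ≤ ∫ x in Bᶜ, (n * K) ∂μ := by
              refine integral_mono_ae (iF n).integrableOn (integrable_const _) (ae_restrict_of_ae ?_)
              filter_upwards [hae] with x hx
              exact (le_abs_self _).trans (Fn_bound s γ n hx)
          _ = μ.real Bᶜ * (n * K) := by simp
          _ ≤ δ * (n * K) := by gcongr
          _ = _ := by ring
    by_contra! hlt
    obtain ⟨n, hn⟩ := exists_nat_gt ((M * (C / m)) / (-s * h - γ - K * δ))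
    rw [div_lt_iff₀ (by linarith)] at hn
    have := step n
    nlinarith
  have : -s * h - γ ≤ 0 := by
    refine le_of_forall_pos_le_add fun δ hδ => ?_
    have := key (δ / (K + 1)) (by positivity)
    have h2 : K * (δ / (K + 1)) ≤ δ := by
      rw [mul_div_assoc', div_le_iff₀ (by positivity)]; nlinarith
    linarith
  linarith

lemma main_bound' (μ : Measure ℝ) [IsProbabilityMeasure μ]
    (hsupp : μ (Set.Ico (0 : ℝ) 1)ᶜ = 0)
    (hinv : ∀ A : Set ℝ, MeasurableSet A → μ (T ⁻¹' A) = μ A)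
    (hac : μ ≪ volume) (s γ : ℝ) (g : ℝ → ℝ) (hg : ContinuousOn g (Set.Icc 0 1))
    (hpos : ∀ x ∈ Set.Icc (0 : ℝ) 1, 0 < g x)
    (hb : ∀ x ∈ Set.Icc (0:ℝ) 1, Lt s g x ≤ Real.exp γ * g x) :
    -s * (∫ x, Real.log (2 * x + 2) ∂μ) ≤ γ := by
  have h01 : (0:ℝ) ≤ 1 := zero_le_one
  let G : ℝ → ℝ := Set.IccExtend h01 ((Set.Icc (0:ℝ) 1).domRestrict g)
  have hGc : Continuous G := (continuousOn_iff_continuous_domRestrict.1 hg).Icc_extend'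
  have hGe : ∀ x ∈ Set.Icc (0:ℝ) 1, G x = g x := fun x hx => Set.IccExtend_of_mem h01 _ hx
  have hGr : ∀ x, ∃ y ∈ Set.Icc (0:ℝ) 1, G x = g y := fun x =>
    ⟨Set.projIcc 0 1 h01 x, (Set.projIcc 0 1 h01 x).2, rfl⟩
  obtain ⟨a, ha, hmin⟩ := isCompact_Icc.exists_isMinOn (Set.nonempty_Icc.2 h01) hg
  obtain ⟨b, hb', hmax⟩ := isCompact_Icc.exists_isMaxOn (Set.nonempty_Icc.2 h01) hg
  refine main_bound μ hsupp hinv hac s γ G hGc (g a) (g b) (hpos a ha) ?_ ?_ ?_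
  · intro x; obtain ⟨y, hy, e⟩ := hGr x; rw [e]; exact hmin hy
  · intro x; obtain ⟨y, hy, e⟩ := hGr x; rw [e]; exact hmax hy
  · intro x hx
    rw [hGe x hx]
    refine le_trans (le_of_eq ?_) (hb x hx)
    unfold Lt
    refine Finset.sum_congr rfl fun i hi => ?_
    rw [hGe]
    obtain ⟨h1, h3⟩ := Finset.mem_Icc.1 hi
    have h1' : (1:ℝ) ≤ i := by exact_mod_cast h1
    have h3' : (i:ℝ) ≤ 3 := by exact_mod_cast h3
    have e1 : 1 ≤ Real.sqrt (i + x) := Real.le_sqrt_of_sq_le (by linarith [hx.1])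
    have e2 : Real.sqrt (i + x) ≤ 2 := Real.sqrt_le_iff.2 ⟨by norm_num, by linarith [hx.2]⟩
    constructor <;> linarith

theorem entropy_bounds (μ : Measure ℝ) [IsProbabilityMeasure μ]
    (hsupp : μ (Set.Ico (0 : ℝ) 1)ᶜ = 0)
    (hinv : ∀ A : Set ℝ, MeasurableSet A → μ (T ⁻¹' A) = μ A)
    (hac : μ ≪ volume)
    (ε α β : ℝ) (hε : 0 < ε) (hα : 0 < α) (hβ : 0 < β)
    (g f : ℝ → ℝ)
    (hg : ContinuousOn g (Set.Icc 0 1)) (hf : ContinuousOn f (Set.Icc 0 1))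
    (hgpos : ∀ x ∈ Set.Icc (0 : ℝ) 1, 0 < g x)
    (hfpos : ∀ x ∈ Set.Icc (0 : ℝ) 1, 0 < f x)
    (hgbound : ∀ x ∈ Set.Icc (0 : ℝ) 1, Lt ε g x ≤ Real.exp (-α) * g x)
    (hfbound : ∀ x ∈ Set.Icc (0 : ℝ) 1, Lt (-ε) f x ≤ Real.exp β * f x) :
    α / ε ≤ (∫ x, Real.log (2 * x + 2) ∂μ) ∧
    (∫ x, Real.log (2 * x + 2) ∂μ) ≤ β / ε := by
  have h1 := main_bound' μ hsupp hinv hac ε (-α) g hg hgpos hgbound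
  have h2 := main_bound' μ hsupp hinv hac (-ε) β f hf hfpos hfbound
  rw [div_le_iff₀ hε, le_div_iff₀ hε]
  constructor <;> linarith
end

section
/- Let T be the Bolyai–Rényi map, let E = {x ∈ [0,1) : Tⁿ(x) ∉ [√2−1, √3−1) for all integers n ≥ 0}, and let Q(t) = limsup_{n→∞} (1/n) log ‖M_tⁿ 1‖_∞. Then the Hausdorff dimension s = dim_H(E) satisfies Q(s) = 0, and s is the unique real number with this property. -/
open MeasureTheory Real Filter

/-- The deleted-digit Cantor set: points whose radical expansion avoids the digit 2. -/
def E : Set ℝ :=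
  {x ∈ Set.Ico (0 : ℝ) 1 |
    ∀ n : ℕ, T^[n] x ∉ Set.Ico (Real.sqrt 2 - 1) (Real.sqrt 3 - 1)}

/-- The deleted-digit transfer operator of the Bolyai–Rényi map at parameter `t`. -/
noncomputable def Mt (t : ℝ) (f : ℝ → ℝ) : ℝ → ℝ := fun x =>
  (2 * Real.sqrt (1 + x)) ^ (-t) * f (Real.sqrt (1 + x) - 1) +
  (2 * Real.sqrt (3 + x)) ^ (-t) * f (Real.sqrt (3 + x) - 1)

/-- Supremum norm over the interval `[0,1]`. -/
noncomputable def supNorm (f : ℝ → ℝ) : ℝ := ⨆ x : Set.Icc (0 : ℝ) 1, |f x|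

/-- The pressure function associated to the deleted-digit transfer operators. -/
noncomputable def Q (t : ℝ) : ℝ :=
  limsup (fun n : ℕ => (1 / n : ℝ) * Real.log (supNorm ((Mt t)^[n] (fun _ => 1)))) atTop


noncomputable def ph (c x : ℝ) : ℝ := Real.sqrt (c + x) - 1
noncomputable def dd (c x : ℝ) : ℝ := 2 * Real.sqrt (c + x)

lemma Mt_eq (t : ℝ) (f : ℝ → ℝ) (x : ℝ) :
    Mt t f x = dd 1 x ^ (-t) * f (ph 1 x) + dd 3 x ^ (-t) * f (ph 3 x) := rfl

lemma sqrt_bd {c x : ℝ} (hc : 1 ≤ c) (hc' : c ≤ 3) (hx : x ∈ Set.Icc (0:ℝ) 1) :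
    1 ≤ √(c + x) ∧ √(c + x) ≤ 2 := by
  constructor
  · rw [Real.one_le_sqrt]; linarith [hx.1]
  · rw [Real.sqrt_le_iff]; constructor <;> linarith [hx.2]

lemma ph_mem {c x : ℝ} (hc : 1 ≤ c) (hc' : c ≤ 3) (hx : x ∈ Set.Icc (0:ℝ) 1) :
    ph c x ∈ Set.Icc (0:ℝ) 1 := by
  have := sqrt_bd hc hc' hx
  unfold ph
  constructor <;> linarith [this.1, this.2]

lemma ph1_mem {x : ℝ} (hx : x ∈ Set.Icc (0:ℝ) 1) : ph 1 x ∈ Set.Icc (0:ℝ) 1 :=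
  ph_mem (by norm_num) (by norm_num) hx
lemma ph3_mem {x : ℝ} (hx : x ∈ Set.Icc (0:ℝ) 1) : ph 3 x ∈ Set.Icc (0:ℝ) 1 :=
  ph_mem (by norm_num) (by norm_num) hx

lemma dd_bd {c x : ℝ} (hc : 1 ≤ c) (hc' : c ≤ 3) (hx : x ∈ Set.Icc (0:ℝ) 1) :
    2 ≤ dd c x ∧ dd c x ≤ 4 := by
  have := sqrt_bd hc hc' hx
  unfold dd
  constructor <;> linarith [this.1, this.2]

lemma dd_nonneg (c x : ℝ) : 0 ≤ dd c x := by unfold dd; positivity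

lemma ddp_nonneg (c x t : ℝ) : 0 ≤ dd c x ^ t := Real.rpow_nonneg (dd_nonneg c x) _

lemma ddp_pos {c x : ℝ} (t : ℝ) (hc : 1 ≤ c) (hc' : c ≤ 3) (hx : x ∈ Set.Icc (0:ℝ) 1) :
    0 < dd c x ^ t := Real.rpow_pos_of_pos (by linarith [(dd_bd hc hc' hx).1]) _

lemma Mt_mono (t : ℝ) {f g : ℝ → ℝ} (h : ∀ x ∈ Set.Icc (0:ℝ) 1, f x ≤ g x) :
    ∀ x ∈ Set.Icc (0:ℝ) 1, Mt t f x ≤ Mt t g x := by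
  intro x hx
  rw [Mt_eq, Mt_eq]
  have h1 := h _ (ph1_mem hx)
  have h3 := h _ (ph3_mem hx)
  have := ddp_nonneg 1 x (-t)
  have := ddp_nonneg 3 x (-t)
  gcongr

lemma iter_mono (t : ℝ) {f g : ℝ → ℝ} (n : ℕ) (h : ∀ x ∈ Set.Icc (0:ℝ) 1, f x ≤ g x) :
    ∀ x ∈ Set.Icc (0:ℝ) 1, (Mt t)^[n] f x ≤ (Mt t)^[n] g x := by
  induction n with
  | zero => simpa using h
  | succ n ih =>
    simp only [Function.iterate_succ_apply']
    exact Mt_mono t ih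

lemma iter_smul (t a : ℝ) (f : ℝ → ℝ) (n : ℕ) :
    (Mt t)^[n] (fun x => a * f x) = fun x => a * (Mt t)^[n] f x := by
  induction n with
  | zero => rfl
  | succ n ih =>
    simp only [Function.iterate_succ_apply', ih]
    funext x
    rw [Mt_eq, Mt_eq]; ring

lemma iter_add (t : ℝ) (f g : ℝ → ℝ) (n : ℕ) :
    (Mt t)^[n] (fun x => f x + g x) = fun x => (Mt t)^[n] f x + (Mt t)^[n] g x := by
  induction n with
  | zero => rfl
  | succ n ih =>
    simp only [Function.iterate_succ_apply', ih]
    funext x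
    simp only [Mt_eq]; ring

/-- `P t n = M_t^n 1`. -/
noncomputable def P (t : ℝ) (n : ℕ) : ℝ → ℝ := (Mt t)^[n] (fun _ => 1)

lemma P_zero (t x : ℝ) : P t 0 x = 1 := rfl
lemma P_succ (t : ℝ) (n : ℕ) (x : ℝ) : P t (n+1) x =
    dd 1 x ^ (-t) * P t n (ph 1 x) + dd 3 x ^ (-t) * P t n (ph 3 x) := by
  unfold P
  rw [Function.iterate_succ_apply', Mt_eq]

lemma P_add (t : ℝ) (m n : ℕ) : P t (m + n) = (Mt t)^[m] (P t n) := by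
  unfold P
  rw [Function.iterate_add_apply]

lemma P_pos (t : ℝ) (n : ℕ) : ∀ x ∈ Set.Icc (0:ℝ) 1, 0 < P t n x := by
  induction n with
  | zero => intro x _; simp [P_zero]
  | succ n ih =>
    intro x hx
    rw [P_succ]
    have h1 := ih _ (ph1_mem hx)
    have h3 := ih _ (ph3_mem hx)
    have := ddp_pos (c := 1) (-t) (by norm_num) (by norm_num) hx
    have := ddp_pos (c := 3) (-t) (by norm_num) (by norm_num) hx
    positivity

/-- comparison in the parameter -/
lemma P_compare (t δ : ℝ) (hδ : 0 ≤ δ) (n : ℕ) : ∀ x ∈ Set.Icc (0:ℝ) 1,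
    ((4:ℝ) ^ (-δ)) ^ n * P t n x ≤ P (t + δ) n x ∧
    P (t + δ) n x ≤ ((2:ℝ) ^ (-δ)) ^ n * P t n x := by
  induction n with
  | zero => intro x _; simp [P_zero]
  | succ n ih =>
    intro x hx
    have key : ∀ c : ℝ, 1 ≤ c → c ≤ 3 →
        ((4:ℝ) ^ (-δ)) ^ (n+1) * (dd c x ^ (-t) * P t n (ph c x)) ≤
          dd c x ^ (-(t+δ)) * P (t+δ) n (ph c x) ∧
        dd c x ^ (-(t+δ)) * P (t+δ) n (ph c x) ≤
          ((2:ℝ) ^ (-δ)) ^ (n+1) * (dd c x ^ (-t) * P t n (ph c x)) := by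
      intro c hc hc'
      obtain ⟨b1, b2⟩ := dd_bd hc hc' hx
      have hm := ph_mem hc hc' hx
      obtain ⟨i1, i2⟩ := ih _ hm
      have p0 := P_pos t n _ hm
      have p1 := P_pos (t+δ) n _ hm
      have e : dd c x ^ (-(t+δ)) = dd c x ^ (-δ) * dd c x ^ (-t) := by
        rw [← Real.rpow_add (by linarith)]; congr 1; ring
      have u1 : (4:ℝ)^(-δ) ≤ dd c x ^ (-δ) :=
        Real.rpow_le_rpow_of_nonpos (by linarith) b2 (by linarith)
      have u2 : dd c x ^ (-δ) ≤ (2:ℝ)^(-δ) :=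
        Real.rpow_le_rpow_of_nonpos (by linarith) b1 (by linarith)
      have q := ddp_pos (-t) hc hc' hx
      have q4 : (0:ℝ) < 4 ^ (-δ) := by positivity
      rw [e]
      constructor
      · calc ((4:ℝ) ^ (-δ)) ^ (n+1) * (dd c x ^ (-t) * P t n (ph c x))
            = ((4:ℝ) ^ (-δ) * dd c x ^ (-t)) * (((4:ℝ) ^ (-δ)) ^ n * P t n (ph c x)) := by ring
          _ ≤ _ := by gcongr
      · calc dd c x ^ (-δ) * dd c x ^ (-t) * P (t+δ) n (ph c x)
            ≤ ((2:ℝ) ^ (-δ) * dd c x ^ (-t)) * (((2:ℝ) ^ (-δ)) ^ n * P t n (ph c x)) := by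
              gcongr
          _ = _ := by ring
    rw [P_succ, P_succ]
    have k1 := key 1 (by norm_num) (by norm_num)
    have k3 := key 3 (by norm_num) (by norm_num)
    constructor
    · rw [mul_add]; exact add_le_add k1.1 k3.1
    · rw [mul_add]; exact add_le_add k1.2 k3.2

lemma P_zero_t (n : ℕ) (x : ℝ) : P 0 n x = 2 ^ n := by
  induction n generalizing x with
  | zero => simp [P_zero]
  | succ n ih => rw [P_succ, ih, ih]; simp; ring

lemma P_bd (t : ℝ) (n : ℕ) : ∃ C, ∀ x ∈ Set.Icc (0:ℝ) 1, P t n x ≤ C := by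
  rcases le_total 0 t with h | h
  · refine ⟨((2:ℝ) ^ (-t)) ^ n * 2 ^ n, fun x hx => ?_⟩
    have := (P_compare 0 t h n x hx).2
    rwa [zero_add, P_zero_t] at this
  · refine ⟨(((4:ℝ) ^ (t)) ^ n)⁻¹ * 2 ^ n, fun x hx => ?_⟩
    have := (P_compare t (-t) (by linarith) n x hx).1
    rw [add_neg_cancel, P_zero_t, neg_neg] at this
    rw [inv_mul_eq_div, le_div_iff₀ (by positivity)]
    linarith

/-- the sup norm -/
noncomputable def A (t : ℝ) (n : ℕ) : ℝ := supNorm (P t n)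

lemma le_A (t : ℝ) (n : ℕ) {x : ℝ} (hx : x ∈ Set.Icc (0:ℝ) 1) : P t n x ≤ A t n := by
  obtain ⟨C, hC⟩ := P_bd t n
  unfold A supNorm
  have : BddAbove (Set.range fun x : Set.Icc (0:ℝ) 1 => |P t n x|) := by
    refine ⟨C, ?_⟩
    rintro _ ⟨y, rfl⟩
    simp only
    rw [abs_of_pos (P_pos t n _ y.2)]
    exact hC _ y.2
  exact (le_abs_self _).trans (le_ciSup this ⟨x, hx⟩)

lemma A_le (t : ℝ) (n : ℕ) {C : ℝ} (h : ∀ x ∈ Set.Icc (0:ℝ) 1, P t n x ≤ C) : A t n ≤ C := by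
  unfold A supNorm
  have : Nonempty (Set.Icc (0:ℝ) 1) := ⟨⟨0, by simp⟩⟩
  refine ciSup_le fun y => ?_
  rw [abs_of_pos (P_pos t n _ y.2)]
  exact h _ y.2

lemma zero_mem_I : (0:ℝ) ∈ Set.Icc (0:ℝ) 1 := by simp

lemma A_pos (t : ℝ) (n : ℕ) : 0 < A t n :=
  (P_pos t n 0 zero_mem_I).trans_le (le_A t n zero_mem_I)

lemma A_submul (t : ℝ) (m n : ℕ) : A t (m + n) ≤ A t m * A t n := by
  refine A_le t _ fun x hx => ?_
  rw [P_add]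
  have h1 := iter_mono t (f := P t n) (g := fun y => A t n * (fun _ => 1) y) m
    (fun y hy => by simpa using le_A t n hy) x hx
  rw [iter_smul] at h1
  refine h1.trans ?_
  rw [mul_comm (A t m)]
  exact mul_le_mul_of_nonneg_left (le_A t m hx) (A_pos t n).le

lemma A_sub (t : ℝ) : Subadditive (fun n => Real.log (A t n)) := by
  intro m n
  rw [← Real.log_mul (A_pos t m).ne' (A_pos t n).ne']
  exact Real.log_le_log (A_pos t _) (A_submul t m n)

lemma A_compare (t δ : ℝ) (hδ : 0 ≤ δ) (n : ℕ) :
    ((4:ℝ) ^ (-δ)) ^ n * A t n ≤ A (t + δ) n ∧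
    A (t + δ) n ≤ ((2:ℝ) ^ (-δ)) ^ n * A t n := by
  constructor
  · have h4 : 0 < ((4:ℝ) ^ (-δ)) ^ n := by positivity
    rw [mul_comm, ← le_div_iff₀ h4]
    refine A_le t n fun x hx => ?_
    rw [le_div_iff₀ h4, mul_comm]
    exact (P_compare t δ hδ n x hx).1.trans (le_A _ _ hx)
  · refine A_le _ n fun x hx => ?_
    refine (P_compare t δ hδ n x hx).2.trans ?_
    have := le_A t n hx
    gcongr

lemma A_zero_t (n : ℕ) : A 0 n = 2 ^ n := by
  apply le_antisymm
  · exact A_le _ _ fun x _ => (P_zero_t n x).le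
  · rw [← P_zero_t n 0]; exact le_A _ _ zero_mem_I

lemma logA_compare (t δ : ℝ) (hδ : 0 ≤ δ) (n : ℕ) (hn : n ≠ 0) :
    Real.log (A t n) / n - δ * Real.log 4 ≤ Real.log (A (t + δ) n) / n ∧
    Real.log (A (t + δ) n) / n ≤ Real.log (A t n) / n - δ * Real.log 2 := by
  obtain ⟨h1, h2⟩ := A_compare t δ hδ n
  have hp := A_pos t n
  have hn' : (0:ℝ) < n := by positivity
  have l1 := Real.log_le_log (by positivity) h1
  have l2 := Real.log_le_log (A_pos _ _) h2
  rw [Real.log_mul (by positivity) hp.ne', Real.log_pow, Real.log_rpow (by norm_num)] at l1 l2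
  constructor
  · rw [le_div_iff₀ hn', sub_mul, div_mul_cancel₀ _ hn'.ne']; linarith
  · rw [div_le_iff₀ hn', sub_mul, div_mul_cancel₀ _ hn'.ne']; linarith

lemma A_bddBelow (t : ℝ) : BddBelow (Set.range fun n : ℕ => Real.log (A t n) / n) := by
  refine ⟨-(|t| * Real.log 4), ?_⟩
  rintro _ ⟨n, rfl⟩
  simp only
  have l4 : 0 ≤ Real.log 4 := Real.log_nonneg (by norm_num)
  have l2 : 0 ≤ Real.log 2 := Real.log_nonneg (by norm_num)
  rcases eq_or_ne n 0 with rfl | hn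
  · simp; positivity
  have hn' : (0:ℝ) < n := by positivity
  have h0 : Real.log (A 0 n) / n = Real.log 2 := by
    rw [A_zero_t, Real.log_pow]; field_simp
  rcases le_total 0 t with h | h
  · have := (logA_compare 0 t h n hn).1
    rw [zero_add, h0] at this
    rw [abs_of_nonneg h]; linarith
  · have := (logA_compare t (-t) (by linarith) n hn).2
    rw [add_neg_cancel, h0] at this
    have := mul_nonneg (neg_nonneg.2 h) l2
    have := mul_nonneg (abs_nonneg t) l4
    linarith

lemma tendsto_Q (t : ℝ) : Tendsto (fun n : ℕ => Real.log (A t n) / n) atTop (nhds (Q t)) := by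
  have h := (A_sub t).tendsto_lim (A_bddBelow t)
  have : Q t = (A_sub t).lim := by
    rw [← h.limsup_eq]
    unfold Q A P
    congr 1
    funext n
    ring
  rw [this]; exact h

lemma Q_le (t : ℝ) (n : ℕ) (hn : n ≠ 0) : Q t ≤ Real.log (A t n) / n := by
  have h := (A_sub t).tendsto_lim (A_bddBelow t)
  rw [tendsto_nhds_unique (tendsto_Q t) h]
  exact (A_sub t).lim_le_div (A_bddBelow t) hn

lemma Q_compare (t δ : ℝ) (hδ : 0 ≤ δ) :
    Q t - δ * Real.log 4 ≤ Q (t + δ) ∧ Q (t + δ) ≤ Q t - δ * Real.log 2 := by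
  constructor
  · refine le_of_tendsto_of_tendsto ((tendsto_Q t).sub_const _) (tendsto_Q (t+δ)) ?_
    filter_upwards [eventually_ne_atTop 0] with n hn using (logA_compare t δ hδ n hn).1
  · refine le_of_tendsto_of_tendsto (tendsto_Q (t+δ)) ((tendsto_Q t).sub_const _) ?_
    filter_upwards [eventually_ne_atTop 0] with n hn using (logA_compare t δ hδ n hn).2

lemma Q_zero : Q 0 = Real.log 2 := by
  refine tendsto_nhds_unique (tendsto_Q 0) (tendsto_const_nhds.congr' ?_)
  filter_upwards [eventually_ne_atTop 0] with n hn
  have hn' : (0:ℝ) < n := by positivity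
  rw [A_zero_t, Real.log_pow]; field_simp

/-! ### Geometry of the maps -/

lemma ph_mono {c u v : ℝ} (huv : u ≤ v) : ph c u ≤ ph c v := by
  unfold ph
  have : √(c+u) ≤ √(c+v) := Real.sqrt_le_sqrt (by linarith)
  linarith

lemma dd_mono {c u v : ℝ} (huv : u ≤ v) : dd c u ≤ dd c v := by
  unfold dd
  have : √(c+u) ≤ √(c+v) := Real.sqrt_le_sqrt (by linarith)
  linarith

/-- Mean value bound for the inverse branches. -/
lemma ph_diff {c u v : ℝ} (hc : 1 ≤ c) (hu : 0 ≤ u) (huv : u ≤ v) :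
    ph c v - ph c u ≤ (dd c u)⁻¹ * (v - u) := by
  have h1 : √(c+u) ≤ √(c+v) := Real.sqrt_le_sqrt (by linarith)
  have h0 : 1 ≤ √(c+u) := by rw [Real.one_le_sqrt]; linarith
  have s1 := Real.sq_sqrt (show 0 ≤ c + u by linarith)
  have s2 := Real.sq_sqrt (show 0 ≤ c + v by linarith)
  unfold ph dd
  rw [inv_mul_eq_div, le_div_iff₀ (by linarith)]
  nlinarith

lemma ph_diff_half {c u v : ℝ} (hc : 1 ≤ c) (hu : 0 ≤ u) (huv : u ≤ v) :
    ph c v - ph c u ≤ (v - u) / 2 := by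
  refine (ph_diff hc hu huv).trans ?_
  have h0 : 1 ≤ √(c+u) := by rw [Real.one_le_sqrt]; linarith
  have : (dd c u)⁻¹ ≤ 2⁻¹ := by
    unfold dd; gcongr; linarith
  nlinarith

lemma dd_distort {c u v : ℝ} (hc : 1 ≤ c) (hu : 0 ≤ u) (huv : u ≤ v) :
    dd c v ≤ dd c u * Real.exp ((v - u) / 2) := by
  unfold dd
  have : √(c+v) ≤ √(c+u) * Real.exp ((v - u)/2) := by
    rw [Real.sqrt_le_iff]
    refine ⟨by positivity, ?_⟩
    rw [mul_pow, Real.sq_sqrt (by linarith), ← Real.exp_nat_mul]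
    have h2 : ((2:ℕ):ℝ) * ((v-u)/2) = v - u := by push_cast; ring
    rw [h2]
    have := Real.add_one_le_exp (v-u)
    nlinarith
  linarith

lemma P_anti {t : ℝ} (ht : 0 ≤ t) (n : ℕ) : ∀ u ∈ Set.Icc (0:ℝ) 1, ∀ v ∈ Set.Icc (0:ℝ) 1,
    u ≤ v → P t n v ≤ P t n u := by
  induction n with
  | zero => intro u _ v _ _; simp [P_zero]
  | succ n ih =>
    intro u hu v hv huv
    rw [P_succ, P_succ]
    have key : ∀ c : ℝ, 1 ≤ c → c ≤ 3 →
        dd c v ^ (-t) * P t n (ph c v) ≤ dd c u ^ (-t) * P t n (ph c u) := by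
      intro c hc hc'
      have a := ih _ (ph_mem hc hc' hu) _ (ph_mem hc hc' hv) (ph_mono huv)
      have b : dd c v ^ (-t) ≤ dd c u ^ (-t) :=
        Real.rpow_le_rpow_of_nonpos (by linarith [(dd_bd hc hc' hu).1]) (dd_mono huv) (by linarith)
      exact mul_le_mul b a (P_pos t n _ (ph_mem hc hc' hv)).le (ddp_nonneg _ _ _)
    exact add_le_add (key 1 (by norm_num) (by norm_num)) (key 3 (by norm_num) (by norm_num))

lemma A_eq {t : ℝ} (ht : 0 ≤ t) (n : ℕ) : A t n = P t n 0 := by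
  apply le_antisymm
  · exact A_le _ _ fun x hx => P_anti ht n 0 zero_mem_I x hx hx.1
  · exact le_A _ _ zero_mem_I

lemma P_distort {t : ℝ} (ht : 0 ≤ t) (n : ℕ) : ∀ u ∈ Set.Icc (0:ℝ) 1, ∀ v ∈ Set.Icc (0:ℝ) 1,
    u ≤ v → P t n u ≤ Real.exp (t * (v - u)) * P t n v := by
  induction n with
  | zero =>
    intro u _ v _ huv
    simp only [P_zero, mul_one]
    exact Real.one_le_exp (mul_nonneg ht (by linarith))
  | succ n ih =>
    intro u hu v hv huv
    rw [P_succ, P_succ]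
    have key : ∀ c : ℝ, 1 ≤ c → c ≤ 3 →
        dd c u ^ (-t) * P t n (ph c u) ≤
          Real.exp (t * (v-u)) * (dd c v ^ (-t) * P t n (ph c v)) := by
      intro c hc hc'
      have a := ih _ (ph_mem hc hc' hu) _ (ph_mem hc hc' hv) (ph_mono huv)
      have a' : P t n (ph c u) ≤ Real.exp (t * ((v-u)/2)) * P t n (ph c v) := by
        refine a.trans ?_
        have := ph_diff_half hc hu.1 huv
        have := (P_pos t n _ (ph_mem hc hc' hv)).le
        gcongr
      have b : dd c u ^ (-t) ≤ Real.exp (t * ((v-u)/2)) * dd c v ^ (-t) := by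
        have h1 := dd_distort hc hu.1 huv
        have pu : 0 < dd c u := by linarith [(dd_bd hc hc' hu).1]
        have pv : 0 < dd c v := by linarith [(dd_bd hc hc' hv).1]
        have h2 : dd c v ^ t ≤ (dd c u * Real.exp ((v - u) / 2)) ^ t :=
          Real.rpow_le_rpow pv.le h1 ht
        rw [Real.mul_rpow pu.le (Real.exp_pos _).le, ← Real.exp_mul] at h2
        rw [Real.rpow_neg pu.le, Real.rpow_neg pv.le, ← div_eq_mul_inv,
          le_div_iff₀ (Real.rpow_pos_of_pos pv _), inv_mul_le_iff₀ (Real.rpow_pos_of_pos pu _)]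
        rwa [mul_comm t]
      have e : Real.exp (t * (v-u)) = Real.exp (t * ((v-u)/2)) * Real.exp (t * ((v-u)/2)) := by
        rw [← Real.exp_add]; congr 1; ring
      calc _ ≤ (Real.exp (t * ((v-u)/2)) * dd c v ^ (-t)) *
            (Real.exp (t * ((v-u)/2)) * P t n (ph c v)) :=
            mul_le_mul b a' (P_pos t n _ (ph_mem hc hc' hu)).le
              (mul_nonneg (Real.exp_pos _).le (ddp_nonneg _ _ _))
        _ = _ := by rw [e]; ring
    rw [mul_add]
    exact add_le_add (key 1 (by norm_num) (by norm_num)) (key 3 (by norm_num) (by norm_num))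

/-- quasi-supermultiplicativity -/
lemma P_super {t : ℝ} (ht : 0 ≤ t) (j k : ℕ) :
    P t k 0 * P t j 0 ≤ Real.exp t * P t (j + k) 0 := by
  rw [P_add]
  have h1 := iter_mono t (f := fun y => P t k 0 * (fun _ => 1) y)
    (g := fun y => Real.exp t * P t k y) j (fun y hy => by
      have := P_distort ht k 0 zero_mem_I y hy hy.1
      simp only [mul_one]
      refine this.trans ?_
      have := (P_pos t k y hy).le
      gcongr
      nlinarith [hy.2]) 0 zero_mem_I
  rw [iter_smul, iter_smul] at h1
  exact h1

/-- If `Q t ≥ 0`, then the partition functions are at least one. -/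
lemma one_le_P {t : ℝ} (ht : 0 ≤ t) (hQ : 0 ≤ Q t) (k : ℕ) : 1 ≤ P t k 0 := by
  rcases eq_or_ne k 0 with rfl | hk
  · simp [P_zero]
  have h := hQ.trans (Q_le t k hk)
  have hk' : (0:ℝ) < k := by positivity
  rw [le_div_iff₀ hk', zero_mul] at h
  rw [← A_eq ht]
  exact (Real.log_nonneg_iff (A_pos t k)).1 h

lemma P_le_of_le {t : ℝ} (ht : 0 ≤ t) (hQ : 0 ≤ Q t) {j m : ℕ} (h : j ≤ m) :
    P t j 0 ≤ Real.exp t * P t m 0 := by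
  have h1 := P_super ht j (m - j)
  rw [Nat.add_sub_cancel' h] at h1
  have := one_le_P ht hQ (m-j)
  have := P_pos t j 0 zero_mem_I
  nlinarith

noncomputable def ind (S : Set ℝ) : ℝ → ℝ := S.indicator (fun _ => 1)

lemma ind_le_one (S : Set ℝ) (x : ℝ) : ind S x ≤ 1 := by
  unfold ind; by_cases h : x ∈ S <;> simp [h]
lemma ind_nonneg (S : Set ℝ) (x : ℝ) : 0 ≤ ind S x := by
  unfold ind; by_cases h : x ∈ S <;> simp [h]

lemma mass_step {t : ℝ} (ht : 0 ≤ t) {c : ℝ} (hc : 1 ≤ c) (hc' : c ≤ 3) {x y ρ : ℝ}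
    (hxy : y - x ≤ ρ) (hρ0 : 0 < ρ) (hρ : ρ ≤ 1/4) :
    ∃ x' y' ρ' D : ℝ, y' - x' ≤ ρ' ∧ 2 * ρ ≤ ρ' ∧ ρ' ≤ 1 ∧ 0 ≤ D ∧
      D * (5 * ρ' / (1 + ρ')) ≤ 5 * ρ / (1 + ρ) ∧
      ∀ z ∈ Set.Icc (0:ℝ) 1,
        dd c z ^ (-t) * ind (Set.Icc x y) (ph c z) ≤ D ^ t * ind (Set.Icc x' y') z := by
  obtain ⟨X, Y, hX0, hXY, hY1, hd, hcl⟩ : ∃ X Y : ℝ, 0 ≤ X ∧ X ≤ Y ∧ Y ≤ 1 ∧ Y - X ≤ ρ ∧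
      ∀ w ∈ Set.Icc (0:ℝ) 1, w ∈ Set.Icc x y → X ≤ w ∧ w ≤ Y := by
    refine ⟨min 1 (max x 0), max (min 1 (max x 0)) (min y 1), ?_, ?_, ?_, ?_, ?_⟩
    · exact le_min zero_le_one (le_max_right _ _)
    · exact le_max_left _ _
    · exact max_le (min_le_left _ _) (min_le_right _ _)
    · rcases max_cases (min 1 (max x 0)) (min y 1) with h | h <;>
      rcases max_cases x 0 with h' | h' <;> rcases min_cases 1 (max x 0) with h'' | h'' <;>
      rcases min_cases y 1 with h3 | h3 <;> linarith
    · intro w hw hw'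
      exact ⟨(min_le_right _ _).trans (max_le hw'.1 hw.1),
        (le_min hw'.2 hw.2).trans (le_max_right _ _)⟩
  have hY0 : 0 ≤ Y := hX0.trans hXY
  refine ⟨(1+X)^2 - c, (1+Y)^2 - c, ρ * (2 + X + Y), (2 * (1 + X))⁻¹, ?_, ?_, ?_, ?_, ?_, ?_⟩
  · nlinarith
  · nlinarith
  · nlinarith
  · positivity
  · have hp : 0 < 1 + ρ * (2 + X + Y) := by positivity
    rw [inv_mul_eq_div, div_div, div_le_div_iff₀ (by positivity) (by positivity)]
    have e1 : 2 + X + Y ≤ (2 + ρ) * (1 + X) := by nlinarith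
    have e2 : (2 + ρ) * (1 + ρ) ≤ 2 * (1 + ρ * (2 + X + Y)) := by nlinarith
    have e3 : (2 + X + Y) * (1 + ρ) ≤ (1 + ρ * (2 + X + Y)) * (2 * (1 + X)) := by
      calc _ ≤ (2 + ρ) * (1 + X) * (1 + ρ) := by gcongr
        _ = ((2 + ρ) * (1 + ρ)) * (1 + X) := by ring
        _ ≤ (2 * (1 + ρ * (2 + X + Y))) * (1 + X) := by gcongr
        _ = _ := by ring
    nlinarith
  · intro z hz
    by_cases h : ph c z ∈ Set.Icc x y
    · obtain ⟨h1, h2⟩ := hcl _ (ph_mem hc hc' hz) h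
      have hz1 : 1 + X ≤ √(c+z) := by unfold ph at h1; linarith
      have hz2 : √(c+z) ≤ 1 + Y := by unfold ph at h2; linarith
      have s := Real.sq_sqrt (show 0 ≤ c + z by linarith [hz.1])
      have hm : z ∈ Set.Icc ((1+X)^2 - c) ((1+Y)^2 - c) := by
        constructor <;> nlinarith
      simp only [ind, Set.indicator_of_mem h, Set.indicator_of_mem hm, mul_one]
      rw [Real.inv_rpow (by positivity), ← Real.rpow_neg (by positivity)]
      exact Real.rpow_le_rpow_of_nonpos (by positivity) (by unfold dd; linarith) (by linarith)
    · have : ind (Set.Icc x y) (ph c z) = 0 := by simp only [ind, Set.indicator_of_notMem h]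
      rw [this, mul_zero]
      exact mul_nonneg (by positivity) (ind_nonneg _ _)

lemma sqrt_gap : √2 + 1/4 < √3 := by
  have h2 : √2 < 1.415 := by rw [Real.sqrt_lt' (by norm_num)]; norm_num
  have h3 : 1.73 < √3 := by rw [Real.lt_sqrt (by norm_num)]; norm_num
  linarith

lemma ph1_le {z : ℝ} (hz : z ≤ 1) : ph 1 z ≤ √2 - 1 := by
  unfold ph
  have : √(1+z) ≤ √2 := Real.sqrt_le_sqrt (by linarith)
  linarith

lemma le_ph3 {z : ℝ} (hz : 0 ≤ z) : √3 - 1 ≤ ph 3 z := by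
  unfold ph
  have : √3 ≤ √(3+z) := Real.sqrt_le_sqrt (by linarith)
  linarith

lemma mass_bound {t : ℝ} (ht : 0 ≤ t) (m : ℕ) : ∀ x y ρ : ℝ, y - x ≤ ρ → ρ ≤ 1 →
    (1/2 : ℝ) ^ m ≤ ρ → ∃ j ≤ m, ∀ z ∈ Set.Icc (0:ℝ) 1,
      (Mt t)^[m] (ind (Set.Icc x y)) z ≤ (5 * ρ / (1 + ρ)) ^ t * P t j z := by
  induction m with
  | zero =>
    intro x y ρ _ h1 h2
    have : ρ = 1 := le_antisymm h1 (by simpa using h2)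
    subst this
    refine ⟨0, le_rfl, fun z hz => ?_⟩
    rw [P_zero]
    have : (1:ℝ) ≤ (5 * 1 / (1 + 1)) ^ t := Real.one_le_rpow (by norm_num) ht
    have := ind_le_one (Set.Icc x y) z
    simp only [Function.iterate_zero, id_eq]
    linarith
  | succ m ih =>
    intro x y ρ hxy h1 h2
    have hρ0 : 0 < ρ := lt_of_lt_of_le (by positivity) h2
    by_cases hρ : 1/4 ≤ ρ
    · refine ⟨m+1, le_rfl, fun z hz => ?_⟩
      have hb : (1:ℝ) ≤ (5 * ρ / (1 + ρ)) ^ t := by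
        apply Real.one_le_rpow _ ht
        rw [le_div_iff₀ (by linarith)]; linarith
      have := iter_mono t (m+1) (fun w _ => ind_le_one (Set.Icc x y) w) z hz
      have hp := P_pos t (m+1) z hz
      refine this.trans ?_
      change P t (m+1) z ≤ _
      nlinarith
    · push Not at hρ
      obtain ⟨c, hc, hc', hMt⟩ : ∃ c : ℝ, 1 ≤ c ∧ c ≤ 3 ∧ ∀ z ∈ Set.Icc (0:ℝ) 1,
          Mt t (ind (Set.Icc x y)) z = dd c z ^ (-t) * ind (Set.Icc x y) (ph c z) := by
        by_cases hy : y < √3 - 1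
        · refine ⟨1, le_rfl, by norm_num, fun z hz => ?_⟩
          have : ph 3 z ∉ Set.Icc x y := fun h => by linarith [h.2, le_ph3 hz.1]
          rw [Mt_eq, ind, Set.indicator_of_notMem this]; simp
        · refine ⟨3, by norm_num, le_rfl, fun z hz => ?_⟩
          have : ph 1 z ∉ Set.Icc x y := fun h => by
            linarith [h.1, ph1_le hz.2, sqrt_gap]
          rw [Mt_eq, ind, Set.indicator_of_notMem this]; simp
      obtain ⟨x', y', ρ', D, g1, g2, g3, g4, g5, g6⟩ := mass_step ht hc hc' hxy hρ0 hρ.le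
      obtain ⟨j, hj, hjj⟩ := ih x' y' ρ' g1 g3 (by rw [pow_succ] at h2; linarith)
      refine ⟨j, by omega, fun z hz => ?_⟩
      rw [Function.iterate_succ_apply]
      have q := iter_mono t (f := Mt t (ind (Set.Icc x y)))
        (g := fun z => D ^ t * ind (Set.Icc x' y') z) m
        (fun z hz => by rw [hMt z hz]; exact g6 z hz) z hz
      rw [iter_smul] at q
      have hD : 0 ≤ D ^ t := by positivity
      have hρ'0 : 0 < ρ' := by linarith
      calc _ ≤ _ := q
        _ ≤ D ^ t * ((5 * ρ' / (1 + ρ')) ^ t * P t j z) :=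
          mul_le_mul_of_nonneg_left (hjj z hz) hD
        _ = (D * (5 * ρ' / (1 + ρ'))) ^ t * P t j z := by
          rw [Real.mul_rpow g4 (by positivity)]; ring
        _ ≤ _ := by
          have := (P_pos t j z hz).le
          gcongr

lemma mass_bound' {t : ℝ} (ht : 0 ≤ t) (hQ : 0 ≤ Q t) (m : ℕ) (x y ρ : ℝ) (hxy : y - x ≤ ρ)
    (h1 : ρ ≤ 1) (h2 : (1/2 : ℝ) ^ m ≤ ρ) :
    (Mt t)^[m] (ind (Set.Icc x y)) 0 ≤ (5 * Real.exp 1 * ρ) ^ t * P t m 0 := by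
  obtain ⟨j, hj, h⟩ := mass_bound ht m x y ρ hxy h1 h2
  have hρ0 : 0 < ρ := lt_of_lt_of_le (by positivity) h2
  refine (h 0 zero_mem_I).trans ?_
  have e : 5 * Real.exp 1 * ρ = (5 * ρ) * Real.exp 1 := by ring
  rw [e, Real.mul_rpow (by positivity) (by positivity), ← Real.exp_mul, one_mul, mul_assoc]
  have h3 := P_le_of_le ht hQ hj
  have hp := (P_pos t j 0 zero_mem_I).le
  have h4 : 5 * ρ / (1 + ρ) ≤ 5 * ρ := div_le_self (by positivity) (by linarith)
  gcongr

/-! ### The set `E` -/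

lemma T_ph1 {z : ℝ} (h0 : 0 ≤ z) (h1 : z < 1) : ph 1 z < √2 - 1 ∧ T (ph 1 z) = z := by
  have hlt : ph 1 z < √2 - 1 := by
    unfold ph
    have : √(1+z) < √2 := Real.sqrt_lt_sqrt (by linarith) (by linarith)
    linarith
  refine ⟨hlt, ?_⟩
  unfold T
  rw [if_pos hlt]
  unfold ph
  have s := Real.sq_sqrt (show 0 ≤ 1 + z by linarith)
  nlinarith

lemma T_ph3 {z : ℝ} (h0 : 0 ≤ z) : T (ph 3 z) = z := by
  have := le_ph3 h0
  have g := sqrt_gap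
  unfold T
  rw [if_neg (by linarith), if_neg (by linarith)]
  unfold ph
  have s := Real.sq_sqrt (show 0 ≤ 3 + z by linarith)
  nlinarith

lemma E_cons {z w : ℝ} (hz : z ∈ E) (hw : w ∈ Set.Ico (0:ℝ) 1) (hT : T w = z)
    (hw' : w ∉ Set.Ico (√2 - 1) (√3 - 1)) : w ∈ E := by
  refine ⟨hw, fun n => ?_⟩
  cases n with
  | zero => simpa using hw'
  | succ n => rw [Function.iterate_succ_apply, hT]; exact hz.2 n

lemma E_ph1 {z : ℝ} (hz : z ∈ E) : ph 1 z ∈ E := by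
  obtain ⟨h1, h2⟩ := T_ph1 hz.1.1 hz.1.2
  have hm := ph1_mem ⟨hz.1.1, hz.1.2.le⟩
  refine E_cons hz ⟨hm.1, ?_⟩ h2 (fun h => by linarith [h.1])
  have h2 : √2 < 1.415 := by rw [Real.sqrt_lt' (by norm_num)]; norm_num
  linarith

lemma E_ph3 {z : ℝ} (hz : z ∈ E) : ph 3 z ∈ E := by
  have hm := ph3_mem ⟨hz.1.1, hz.1.2.le⟩
  refine E_cons hz ⟨hm.1, ?_⟩ (T_ph3 hz.1.1) (fun h => by linarith [h.2, le_ph3 hz.1.1])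
  unfold ph
  have : √(3+z) < 2 := by
    rw [Real.sqrt_lt' (by norm_num)]; linarith [hz.1.2]
  linarith

lemma one_lt_sqrt2 : 1 < √2 := by
  rw [Real.lt_sqrt (by norm_num)]; norm_num

lemma zero_mem_E : (0:ℝ) ∈ E := by
  have hT : T 0 = 0 := by
    unfold T
    rw [if_pos (by linarith [one_lt_sqrt2])]; simp
  refine ⟨by simp, fun n => ?_⟩
  rw [Function.iterate_fixed hT]
  intro h
  linarith [h.1, one_lt_sqrt2]

lemma iter_congr_E (t : ℝ) {f g : ℝ → ℝ} (n : ℕ) (h : ∀ x ∈ E, f x = g x) :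
    ∀ x ∈ E, (Mt t)^[n] f x = (Mt t)^[n] g x := by
  induction n with
  | zero => simpa using h
  | succ n ih =>
    intro x hx
    simp only [Function.iterate_succ_apply', Mt_eq]
    rw [ih _ (E_ph1 hx), ih _ (E_ph3 hx)]

lemma T_nonneg {x : ℝ} (hx : 0 ≤ x) : 0 ≤ T x := by
  have s2 := Real.sq_sqrt (show (0:ℝ) ≤ 2 by norm_num)
  have s3 := Real.sq_sqrt (show (0:ℝ) ≤ 3 by norm_num)
  have p2 := Real.sqrt_nonneg 2
  have p3 := Real.sqrt_nonneg 3
  unfold T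
  split_ifs with h1 h2
  · positivity
  · push Not at h1; nlinarith
  · push Not at h2; nlinarith

lemma T_right {x : ℝ} (hx : 0 ≤ x) : Tendsto T (nhdsWithin x (Set.Ici x))
    (nhdsWithin (T x) (Set.Ici (T x))) := by
  have g := sqrt_gap
  obtain ⟨k, hk⟩ : ∃ k : ℝ, ∀ᶠ y in nhdsWithin x (Set.Ici x), T y = y ^ 2 + 2 * y - k := by
    by_cases h1 : x < √2 - 1
    · refine ⟨0, ?_⟩
      filter_upwards [mem_nhdsWithin_of_mem_nhds (Iio_mem_nhds h1)] with y hy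
      simp only [T, if_pos (Set.mem_Iio.1 hy)]; ring
    · by_cases h2 : x < √3 - 1
      · refine ⟨1, ?_⟩
        filter_upwards [mem_nhdsWithin_of_mem_nhds (Iio_mem_nhds h2), self_mem_nhdsWithin]
          with y hy hy'
        rw [Set.mem_Iio] at hy
        rw [Set.mem_Ici] at hy'
        unfold T
        rw [if_neg (by linarith), if_pos hy]
      · refine ⟨2, ?_⟩
        filter_upwards [self_mem_nhdsWithin] with y hy'
        rw [Set.mem_Ici] at hy'
        unfold T
        rw [if_neg (by linarith), if_neg (by linarith)]
  have hx' : T x = x ^ 2 + 2 * x - k := hk.self_of_nhdsWithin (Set.mem_Ici.2 le_rfl)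
  rw [tendsto_nhdsWithin_iff]
  constructor
  · have : Continuous (fun y : ℝ => y ^ 2 + 2 * y - k) := by fun_prop
    rw [hx']
    exact ((this.tendsto x).mono_left nhdsWithin_le_nhds).congr' (hk.mono fun y hy => hy.symm)
  · filter_upwards [hk, self_mem_nhdsWithin] with y hy hy'
    rw [Set.mem_Ici] at hy' ⊢
    rw [hy, hx']
    nlinarith

lemma T_iter_right (n : ℕ) : ∀ x : ℝ, 0 ≤ x → Tendsto T^[n] (nhdsWithin x (Set.Ici x))
    (nhdsWithin (T^[n] x) (Set.Ici (T^[n] x))) := by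
  induction n with
  | zero => intro x _; exact tendsto_id
  | succ n ih =>
    intro x hx
    rw [Function.iterate_succ_apply, Function.iterate_succ]
    exact (ih _ (T_nonneg hx)).comp (T_right hx)

/-- `E` is closed under limits from the right. -/
lemma E_right {x : ℝ} (hx : x ∈ Set.Ico (0:ℝ) 1)
    (h : ∀ y, x < y → y ≤ 1 → (Set.Ioc x y ∩ E).Nonempty) : x ∈ E := by
  refine ⟨hx, fun n hn => ?_⟩
  have h1 : Set.Ico (√2 - 1) (√3 - 1) ∈ nhdsWithin (T^[n] x) (Set.Ici (T^[n] x)) := by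
    filter_upwards [self_mem_nhdsWithin, mem_nhdsWithin_of_mem_nhds (Iio_mem_nhds hn.2)]
      with y hy hy'
    exact ⟨hn.1.trans hy, hy'⟩
  have h2 := T_iter_right n x hx.1 h1
  rw [Filter.mem_map, mem_nhdsGE_iff_exists_Ico_subset] at h2
  obtain ⟨u, hu, hsub⟩ := h2
  rw [Set.mem_Ioi] at hu
  obtain ⟨w, hw, hwE⟩ := h (min 1 ((x+u)/2)) (lt_min hx.2 (by linarith)) (min_le_left _ _)
  have : w ∈ Set.Ico x u := ⟨hw.1.le, by linarith [hw.2.trans (min_le_right _ _)]⟩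
  exact hwE.2 n (hsub this)

/-! ### Upper bound -/

lemma T_inv {y : ℝ} (hy : y ∈ Set.Ico (0:ℝ) 1) (hy' : y ∉ Set.Ico (√2 - 1) (√3 - 1)) :
    T y ∈ Set.Ico (0:ℝ) 1 ∧ (y = ph 1 (T y) ∨ y = ph 3 (T y)) := by
  have s2 := Real.sq_sqrt (show (0:ℝ) ≤ 2 by norm_num)
  have s3 := Real.sq_sqrt (show (0:ℝ) ≤ 3 by norm_num)
  have p2 := Real.sqrt_nonneg 2
  have p3 := Real.sqrt_nonneg 3
  have g := sqrt_gap
  refine ⟨⟨T_nonneg hy.1, ?_⟩, ?_⟩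
  · unfold T
    split_ifs with h1 h2
    · nlinarith [hy.1]
    · exact absurd ⟨not_lt.1 h1, h2⟩ hy'
    · nlinarith [hy.1, hy.2]
  · by_cases h1 : y < √2 - 1
    · left
      have : 1 + T y = (1+y)^2 := by unfold T; rw [if_pos h1]; ring
      unfold ph
      rw [this, Real.sqrt_sq (by linarith [hy.1])]; ring
    · right
      have h2 : ¬ y < √3 - 1 := fun h2 => hy' ⟨not_lt.1 h1, h2⟩
      have : 3 + T y = (1+y)^2 := by unfold T; rw [if_neg h1, if_neg h2]; ring
      unfold ph
      rw [this, Real.sqrt_sq (by linarith [hy.1])]; ring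

lemma T_iter_mem {x : ℝ} (hx : x ∈ E) (n : ℕ) : T^[n] x ∈ Set.Ico (0:ℝ) 1 := by
  induction n with
  | zero => exact hx.1
  | succ n ih =>
    rw [Function.iterate_succ_apply']
    exact (T_inv ih (hx.2 n)).1

open OuterMeasure in
lemma pre_bound {t : ℝ} (ht : 0 < t) (r : ENNReal) (n : ℕ) : ∀ u ∈ Set.Icc (0:ℝ) 1,
    ∀ v ∈ Set.Icc (0:ℝ) 1, u ≤ v → ENNReal.ofReal ((v - u) * (1/2)^n) ≤ r →
    mkMetric'.pre (fun s : Set ℝ => Metric.ediam s ^ t) r {x ∈ E | T^[n] x ∈ Set.Icc u v}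
      ≤ ENNReal.ofReal (P t n u * (v - u) ^ t) := by
  induction n with
  | zero =>
    intro u hu v hv huv hr
    have hd : Metric.ediam {x ∈ E | T^[0] x ∈ Set.Icc u v} ≤ ENNReal.ofReal (v - u) := by
      refine (Metric.ediam_mono (t := Set.Icc u v) fun x hx => hx.2).trans ?_
      rw [Real.ediam_Icc]
    simp only [pow_zero, mul_one] at hr
    refine (mkMetric'.pre_le (hd.trans hr)).trans ?_
    rw [P_zero, one_mul, ← ENNReal.ofReal_rpow_of_nonneg (by linarith) ht.le]
    gcongr
  | succ n ih =>
    intro u hu v hv huv hr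
    have key : ∀ c : ℝ, 1 ≤ c → c ≤ 3 →
        mkMetric'.pre (fun s : Set ℝ => Metric.ediam s ^ t) r
          {x ∈ E | T^[n] x ∈ Set.Icc (ph c u) (ph c v)}
        ≤ ENNReal.ofReal (dd c u ^ (-t) * P t n (ph c u) * (v - u) ^ t) := by
      intro c hc hc'
      refine (ih _ (ph_mem hc hc' hu) _ (ph_mem hc hc' hv) (ph_mono huv) ?_).trans ?_
      · refine le_trans (ENNReal.ofReal_le_ofReal ?_) hr
        have := ph_diff_half hc hu.1 huv
        rw [pow_succ]
        have : (0:ℝ) < (1/2)^n := by positivity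
        nlinarith
      · apply ENNReal.ofReal_le_ofReal
        have h1 := ph_diff hc hu.1 huv
        have h0 : 0 ≤ ph c v - ph c u := sub_nonneg.2 (ph_mono huv)
        have h2 := Real.rpow_le_rpow h0 h1 ht.le
        rw [Real.mul_rpow (inv_nonneg.2 (dd_nonneg _ _)) (by linarith),
          Real.inv_rpow (dd_nonneg _ _), ← Real.rpow_neg (dd_nonneg _ _)] at h2
        have hp := (P_pos t n _ (ph_mem hc hc' hu)).le
        calc _ ≤ P t n (ph c u) * (dd c u ^ (-t) * (v-u)^t) := by gcongr
          _ = _ := by ring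
    have hsub : {x ∈ E | T^[n+1] x ∈ Set.Icc u v} ⊆
        {x ∈ E | T^[n] x ∈ Set.Icc (ph 1 u) (ph 1 v)} ∪
        {x ∈ E | T^[n] x ∈ Set.Icc (ph 3 u) (ph 3 v)} := by
      rintro x ⟨hx, hx'⟩
      rw [Function.iterate_succ_apply'] at hx'
      rcases (T_inv (T_iter_mem hx n) (hx.2 n)).2 with h | h
      · left
        refine ⟨hx, ?_⟩
        rw [h]; exact ⟨ph_mono hx'.1, ph_mono hx'.2⟩
      · right
        refine ⟨hx, ?_⟩
        rw [h]; exact ⟨ph_mono hx'.1, ph_mono hx'.2⟩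
    refine (measure_mono hsub).trans ((measure_union_le _ _).trans ?_)
    refine (add_le_add (key 1 (by norm_num) (by norm_num))
      (key 3 (by norm_num) (by norm_num))).trans ?_
    have hvu : 0 ≤ (v-u)^t := Real.rpow_nonneg (by linarith) _
    rw [← ENNReal.ofReal_add, P_succ, add_mul]
    · exact mul_nonneg (mul_nonneg (ddp_nonneg _ _ _) (P_pos t n _ (ph1_mem hu)).le) hvu
    · exact mul_nonneg (mul_nonneg (ddp_nonneg _ _ _) (P_pos t n _ (ph3_mem hu)).le) hvu

lemma P_tendsto {t : ℝ} (hQ : Q t < 0) : Tendsto (fun n => P t n 0) atTop (nhds 0) := by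
  have h := (tendsto_Q t).eventually (gt_mem_nhds (show Q t < Q t / 2 by linarith))
  have h2 : Tendsto (fun n : ℕ => (Real.exp (Q t / 2)) ^ n) atTop (nhds 0) :=
    tendsto_pow_atTop_nhds_zero_of_lt_one (Real.exp_pos _).le
      (by rw [← Real.exp_zero]; exact Real.exp_lt_exp.2 (by linarith))
  refine squeeze_zero' (Eventually.of_forall fun n => (P_pos t n 0 zero_mem_I).le) ?_ h2
  filter_upwards [h, eventually_ne_atTop 0] with n hn hn0
  have hn' : (0:ℝ) < n := by positivity
  rw [div_lt_iff₀ hn'] at hn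
  refine (le_A t n zero_mem_I).trans ?_
  rw [← Real.exp_nat_mul, ← Real.log_le_iff_le_exp (A_pos t n)]
  linarith

lemma dim_upper {t : ℝ} (ht : 0 < t) (hQ : Q t < 0) : dimH E ≤ ENNReal.ofReal t := by
  have hz : μH[t] E = 0 := by
    rw [Measure.hausdorffMeasure, ← OuterMeasure.coe_mkMetric, OuterMeasure.mkMetric,
      OuterMeasure.mkMetric']
    simp only [OuterMeasure.iSup_apply, ENNReal.iSup_eq_zero]
    intro r hr
    have hlim : Tendsto (fun n => ENNReal.ofReal (P t n 0)) atTop (nhds 0) := by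
      simpa using ENNReal.tendsto_ofReal (P_tendsto hQ)
    have hlim2 : Tendsto (fun n : ℕ => ENNReal.ofReal ((1 - 0) * (1/2:ℝ)^n)) atTop (nhds 0) := by
      have : Tendsto (fun n : ℕ => (1 - 0) * (1/2:ℝ)^n) atTop (nhds 0) := by
        simpa using tendsto_pow_atTop_nhds_zero_of_lt_one (r := (1/2:ℝ)) (by norm_num) (by norm_num)
      simpa using ENNReal.tendsto_ofReal this
    refine le_antisymm (ge_of_tendsto hlim ?_) zero_le
    filter_upwards [hlim2.eventually (gt_mem_nhds hr)] with n hn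
    have := pre_bound ht r n 0 zero_mem_I 1 (by simp) zero_le_one hn.le
    refine le_trans (measure_mono ?_) (this.trans (by simp))
    intro x hx
    have := T_iter_mem hx n
    exact ⟨hx, this.1, this.2.le⟩
  have : dimH E ≤ (t.toNNReal : ENNReal) := by
    apply dimH_le_of_hausdorffMeasure_ne_top
    simp [Real.coe_toNNReal t ht.le, hz]
  exact this

/-! ### Lower bound -/

noncomputable def gm (t : ℝ) (m : ℕ) (x : ℝ) : ℝ := (Mt t)^[m] (ind (Set.Iic x)) 0 / P t m 0

lemma gm_mem (t : ℝ) (m : ℕ) (x : ℝ) : gm t m x ∈ Set.Icc (0:ℝ) 1 := by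
  have hp := P_pos t m 0 zero_mem_I
  have h1 := iter_mono t m (fun w _ => ind_le_one (Set.Iic x) w) 0 zero_mem_I
  have h0 := iter_mono t (f := fun w => 0 * (fun _ => 1) w) m
    (fun w _ => by simpa using ind_nonneg (Set.Iic x) w) 0 zero_mem_I
  rw [iter_smul] at h0
  unfold gm
  refine ⟨div_nonneg (by simpa using h0) hp.le, ?_⟩
  rw [div_le_one hp]
  exact h1

lemma gm_diff (t : ℝ) (m : ℕ) {x y : ℝ} (hxy : x ≤ y) :
    gm t m y = gm t m x + (Mt t)^[m] (ind (Set.Ioc x y)) 0 / P t m 0 := by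
  unfold gm
  rw [← add_div]
  congr 1
  have : ind (Set.Iic y) = fun z => ind (Set.Iic x) z + ind (Set.Ioc x y) z := by
    funext z
    unfold ind
    rw [← Set.Iic_union_Ioc_eq_Iic hxy, Set.indicator_union_of_disjoint]
    rw [Set.disjoint_left]
    intro a ha hb
    exact absurd hb.1 (not_lt.2 ha)
  rw [this, iter_add]

lemma gm_one (t : ℝ) (m : ℕ) : gm t m 1 = 1 := by
  have hp := P_pos t m 0 zero_mem_I
  unfold gm
  rw [div_eq_one_iff_eq hp.ne']
  refine iter_congr_E t m (fun x hx => ?_) 0 zero_mem_E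
  rw [ind, Set.indicator_of_mem (Set.mem_Iic.2 hx.1.2.le)]

lemma gm_const (t : ℝ) (m : ℕ) {x y : ℝ} (hxy : x ≤ y) (h : ¬ (Set.Ioc x y ∩ E).Nonempty) :
    gm t m y = gm t m x := by
  rw [gm_diff t m hxy]
  have h1 := iter_congr_E t (f := ind (Set.Ioc x y)) (g := fun w => 0 * (fun _ => 1) w) m
    (fun w hw => by
      have : w ∉ Set.Ioc x y := fun h' => h ⟨w, h', hw⟩
      rw [ind, Set.indicator_of_notMem this]; simp) 0 zero_mem_E
  rw [iter_smul] at h1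
  rw [h1]; simp

lemma gm_holder {t : ℝ} (ht : 0 ≤ t) (hQ : 0 ≤ Q t) (m : ℕ) {x y ρ : ℝ} (hxy : x ≤ y)
    (hρ : y - x ≤ ρ) (h1 : ρ ≤ 1) (h2 : (1/2:ℝ)^m ≤ ρ) :
    gm t m x ≤ gm t m y ∧ gm t m y ≤ gm t m x + (5 * Real.exp 1 * ρ) ^ t := by
  have hp := P_pos t m 0 zero_mem_I
  rw [gm_diff t m hxy]
  constructor
  · have h0 := iter_mono t (f := fun w => 0 * (fun _ => 1) w) m
      (fun w _ => by simpa using ind_nonneg (Set.Ioc x y) w) 0 zero_mem_I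
    rw [iter_smul] at h0
    have := div_nonneg (show 0 ≤ (Mt t)^[m] (ind (Set.Ioc x y)) 0 by simpa using h0) hp.le
    linarith
  · have h3 := mass_bound' ht hQ m x y ρ hρ h1 h2
    have h4 := iter_mono t (f := ind (Set.Ioc x y)) (g := ind (Set.Icc x y)) m
      (fun w _ => Set.indicator_le_indicator_of_subset Set.Ioc_subset_Icc_self
        (fun _ => zero_le_one) w) 0 zero_mem_I
    have := (div_le_iff₀ hp).2 (h4.trans h3)
    linarith

lemma gm_zero {t : ℝ} (ht : 0 ≤ t) (hQ : 0 ≤ Q t) (m : ℕ) :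
    gm t m 0 ≤ (5 * Real.exp 1 * (1/2)^m) ^ t := by
  have hp := P_pos t m 0 zero_mem_I
  have h3 := mass_bound' ht hQ m 0 0 ((1/2)^m) (by simp)
    (pow_le_one₀ (by norm_num) (by norm_num)) le_rfl
  unfold gm
  rw [div_le_iff₀ hp]
  refine le_trans (le_of_eq ?_) h3
  refine iter_congr_E t m (fun x hx => ?_) 0 zero_mem_E
  unfold ind
  by_cases h : x ∈ Set.Iic (0:ℝ)
  · rw [Set.indicator_of_mem h, Set.indicator_of_mem (show x ∈ Set.Icc (0:ℝ) 0 from ⟨hx.1.1, h⟩)]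
  · rw [Set.indicator_of_notMem h, Set.indicator_of_notMem (fun h' => h h'.2)]

lemma exists_g {t : ℝ} (ht : 0 < t) (hQ : 0 ≤ Q t) : ∃ g : ℝ → ℝ, g 0 = 0 ∧ g 1 = 1 ∧
    (∀ x y, x ≤ y → y - x ≤ 1 → |g y - g x| ≤ (5 * Real.exp 1 * (y - x)) ^ t) ∧
    (∀ x y, x ≤ y → ¬ (Set.Ioc x y ∩ E).Nonempty → g y = g x) := by
  let U : Ultrafilter ℕ := Filter.hyperfilter ℕ
  have hU : (U : Filter ℕ) ≤ atTop := by
    rw [← Nat.cofinite_eq_atTop]; exact Filter.hyperfilter_le_cofinite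
  have hex : ∀ x, ∃ l, Tendsto (fun m => gm t m x) U (nhds l) := by
    intro x
    obtain ⟨l, _, hl⟩ := (isCompact_Icc (a := (0:ℝ)) (b := 1)).ultrafilter_le_nhds
      (U.map (fun m => gm t m x)) (by
        rw [Filter.le_principal_iff]
        exact Ultrafilter.mem_map.2 (Filter.univ_mem' (fun m => gm_mem t m x)))
    exact ⟨l, hl⟩
  choose g hg using hex
  have hpow : Tendsto (fun m : ℕ => (1/2:ℝ)^m) atTop (nhds 0) :=
    tendsto_pow_atTop_nhds_zero_of_lt_one (by norm_num) (by norm_num)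
  refine ⟨g, ?_, ?_, ?_, ?_⟩
  · apply le_antisymm
    · have h1 : Tendsto (fun m : ℕ => (5 * Real.exp 1 * (1/2)^m) ^ t) atTop (nhds 0) := by
        have := (hpow.const_mul (5 * Real.exp 1)).rpow_const (p := t) (Or.inr ht.le)
        simpa [Real.zero_rpow ht.ne'] using this
      exact le_of_tendsto_of_tendsto' (hg 0) (h1.mono_left hU) (fun m => gm_zero ht.le hQ m)
    · exact ge_of_tendsto' (hg 0) (fun m => (gm_mem t m 0).1)
  · refine tendsto_nhds_unique (hg 1) ?_
    simp only [gm_one]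
    exact tendsto_const_nhds
  · intro x y hxy hxy1
    rcases hxy.eq_or_lt with rfl | hlt
    · simp [Real.zero_rpow ht.ne']
    have hev : ∀ᶠ m in (U : Filter ℕ), (1/2:ℝ)^m ≤ y - x :=
      hU ((hpow.eventually (gt_mem_nhds (sub_pos.2 hlt))).mono fun m hm => le_of_lt hm)
    have h1 : g x ≤ g y := le_of_tendsto_of_tendsto (hg x) (hg y)
      (hev.mono fun m hm => (gm_holder ht.le hQ m hxy le_rfl hxy1 hm).1)
    have h2 : g y ≤ g x + (5 * Real.exp 1 * (y - x)) ^ t :=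
      le_of_tendsto_of_tendsto (hg y) ((hg x).add_const _)
      (hev.mono fun m hm => (gm_holder ht.le hQ m hxy le_rfl hxy1 hm).2)
    rw [abs_of_nonneg (by linarith)]
    linarith
  · intro x y hxy h
    refine tendsto_nhds_unique (hg y) ?_
    simp only [gm_const t _ hxy h]
    exact hg x

lemma dim_lower {t : ℝ} (ht : 0 < t) (hQ : 0 ≤ Q t) : ENNReal.ofReal t ≤ dimH E := by
  obtain ⟨g, g0, g1, gH, gE⟩ := exists_g ht hQ
  have gH' : ∀ x ∈ Set.Icc (0:ℝ) 1, ∀ y ∈ Set.Icc (0:ℝ) 1,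
      |g x - g y| ≤ (5 * Real.exp 1 * |x - y|) ^ t := by
    intro x hx y hy
    rcases le_total x y with h | h
    · rw [abs_sub_comm, abs_sub_comm x, abs_of_nonneg (sub_nonneg.2 h)]
      exact gH x y h (by linarith [hx.1, hy.2])
    · rw [abs_of_nonneg (sub_nonneg.2 h)]
      exact gH y x h (by linarith [hy.1, hx.2])
  let r : NNReal := t.toNNReal
  have hrt : (r : ℝ) = t := Real.coe_toNNReal t ht.le
  have hr0 : 0 < r := Real.toNNReal_pos.2 ht
  let C : NNReal := ((5 * Real.exp 1) ^ t).toNNReal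
  have hol : HolderOnWith C r g (Set.Icc 0 1) := by
    intro x hx y hy
    rw [edist_dist, edist_dist, Real.dist_eq, Real.dist_eq]
    have h := gH' x hx y hy
    rw [Real.mul_rpow (by positivity) (abs_nonneg _)] at h
    rw [hrt, ENNReal.ofReal_rpow_of_nonneg (abs_nonneg _) ht.le]
    have hC : (C : ENNReal) = ENNReal.ofReal ((5 * Real.exp 1) ^ t) := rfl
    rw [hC, ← ENNReal.ofReal_mul (by positivity)]
    exact ENNReal.ofReal_le_ofReal h
  have hcont : ContinuousOn g (Set.Icc 0 1) := hol.continuousOn hr0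
  have hEI : E ⊆ Set.Icc 0 1 := fun x hx => ⟨hx.1.1, hx.1.2.le⟩
  have hsurj : Set.Ico (0:ℝ) 1 ⊆ g '' E := by
    intro v hv
    have hne : (Set.Icc (0:ℝ) 1 ∩ g ⁻¹' {v}).Nonempty := by
      obtain ⟨x, hx, hxv⟩ := intermediate_value_Icc zero_le_one hcont
        (show v ∈ Set.Icc (g 0) (g 1) by rw [g0, g1]; exact ⟨hv.1, hv.2.le⟩)
      exact ⟨x, hx, hxv⟩
    have hcomp : IsCompact (Set.Icc (0:ℝ) 1 ∩ g ⁻¹' {v}) :=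
      isCompact_Icc.of_isClosed_subset
        (hcont.preimage_isClosed_of_isClosed isClosed_Icc isClosed_singleton)
        Set.inter_subset_left
    obtain ⟨x, ⟨hx, hxv⟩, hmax⟩ := hcomp.exists_isGreatest hne
    rw [Set.mem_preimage, Set.mem_singleton_iff] at hxv
    refine ⟨x, ?_, hxv⟩
    have hx1 : x < 1 := by
      refine lt_of_le_of_ne hx.2 fun h => ?_
      rw [h, g1] at hxv
      linarith [hv.2]
    refine E_right ⟨hx.1, hx1⟩ fun y hxy hy1 => ?_
    by_contra hcon
    have := gE x y hxy.le hcon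
    have h2 := hmax (show y ∈ Set.Icc (0:ℝ) 1 ∩ g ⁻¹' {v} from
      ⟨⟨hx.1.trans hxy.le, hy1⟩, by rw [Set.mem_preimage, this]; exact hxv⟩)
    linarith
  have h1 : dimH (Set.Ico (0:ℝ) 1) = 1 := by
    rw [Real.dimH_of_nonempty_interior (by rw [interior_Ico]; exact ⟨1/2, by norm_num, by norm_num⟩)]
    simp
  have h2 := (dimH_mono hsurj).trans ((hol.mono hEI).dimH_image_le hr0)
  rw [h1] at h2
  have hr : (r : ENNReal) = ENNReal.ofReal t := rfl
  rw [hr] at h2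
  rw [ENNReal.le_div_iff_mul_le (Or.inl (by simpa using ht)) (Or.inl ENNReal.ofReal_ne_top),
    one_mul] at h2
  exact h2

theorem bowen_dimension :
    Q (dimH E).toReal = 0 ∧ ∀ s : ℝ, Q s = 0 → s = (dimH E).toReal := by
  have l2 : 0 < Real.log 2 := Real.log_pos (by norm_num)
  have l4 : 0 < Real.log 4 := Real.log_pos (by norm_num)
  have hfin : dimH E ≠ ⊤ := Real.dimH_ne_top E
  set d := (dimH E).toReal with hd
  have hd0 : 0 ≤ d := ENNReal.toReal_nonneg
  have hup : ∀ t, 0 < t → Q t < 0 → d ≤ t := fun t ht hQ =>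
    ENNReal.toReal_le_of_le_ofReal ht.le (dim_upper ht hQ)
  have hlo : ∀ t, 0 < t → 0 ≤ Q t → t ≤ d := fun t ht hQ =>
    (ENNReal.ofReal_le_iff_le_toReal hfin).1 (dim_lower ht hQ)
  have hmain : Q d = 0 := by
    rcases lt_trichotomy (Q d) 0 with h | h | h
    · exfalso
      have hdpos : 0 < d := by
        refine lt_of_le_of_ne hd0 fun h0 => ?_
        rw [← h0, Q_zero] at h
        linarith
      set ε := min (d/2) (-Q d / (2 * Real.log 4)) with hε
      have hεpos : 0 < ε := lt_min (by linarith) (div_pos (by linarith) (by linarith))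
      have h1 := (Q_compare (d - ε) ε hεpos.le).1
      rw [sub_add_cancel] at h1
      have h2 : ε * Real.log 4 ≤ -Q d / 2 := by
        have : ε ≤ -Q d / (2 * Real.log 4) := min_le_right _ _
        rw [le_div_iff₀ (by linarith)] at this
        linarith
      have := hup (d - ε) (by linarith [min_le_left (d/2) (-Q d / (2 * Real.log 4))]) (by linarith)
      linarith
    · exact h
    · exfalso
      set ε := Q d / Real.log 4 with hε
      have hεpos : 0 < ε := div_pos h l4
      have h1 := (Q_compare d ε hεpos.le).1
      have h2 : ε * Real.log 4 = Q d := div_mul_cancel₀ _ l4.ne'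
      have := hlo (d + ε) (by linarith) (by linarith)
      linarith
  refine ⟨hmain, fun s hs => ?_⟩
  rcases lt_trichotomy s d with h | h | h
  · have := (Q_compare s (d - s) (by linarith)).2
    rw [add_sub_cancel, hs, hmain] at this
    nlinarith
  · exact h
  · have := (Q_compare d (s - d) (by linarith)).2
    rw [add_sub_cancel, hs, hmain] at this
    nlinarith
end
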